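/- Let p be even and q = mp + α with 0 < α < p, both even. Define G₄ = E_p + [ (m+1)·B_{α,p} stacked above m·B_{p−α,p} ] − W_p^{−α} ∈ M_p(ℤ), where B_{k,p} is the k×p matrix with all rows (−2,2,−2,…) and W_p the cyclic shift. Then, with r = gcd(p, α) (equivalently gcd(p,q)), p = p'r, α = α'r, q = q'r, G₄ is ℤ-equivalent to diag(2p'q', 0^{(r−1)}, 1^{(p−r)}) (up to reordering of diagonal entries). -/

import Mathlib

open Matrix

namespace G4

/-- Integer equivalence of square matrices. -/
def ZEq {ι : Type*} [Fintype ι] [DecidableEq ι] (A B : Matrix ι ι ℤ) : Prop :=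
  ∃ U V : Matrix ι ι ℤ, IsUnit U.det ∧ IsUnit V.det ∧ U * A * V = B

section
variable {ι : Type*} [Fintype ι] [DecidableEq ι]

lemma ZEq.trans {A B C : Matrix ι ι ℤ} (h : ZEq A B) (h' : ZEq B C) : ZEq A C := by
  obtain ⟨U, V, hU, hV, rfl⟩ := h
  obtain ⟨U', V', hU', hV', rfl⟩ := h'
  refine ⟨U' * U, V * V', ?_, ?_, ?_⟩
  · rw [det_mul]; exact hU'.mul hU
  · rw [det_mul]; exact hV.mul hV'
  · simp only [Matrix.mul_assoc]

lemma isUnit_det_transv (x y : ι → ℤ) (h : y ⬝ᵥ x = 0) :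
    IsUnit (1 + vecMulVec x y).det := by
  have : (1 + vecMulVec x y) * (1 - vecMulVec x y) = 1 := by
    simp [add_mul, mul_sub, vecMulVec_mul_vecMulVec, h]
  exact IsUnit.of_mul_eq_one (b := (1 - vecMulVec x y).det) (by rw [← det_mul, this, det_one])

lemma ZEq.left {A : Matrix ι ι ℤ} (x y : ι → ℤ) (h : y ⬝ᵥ x = 0) :
    ZEq A ((1 + vecMulVec x y) * A) :=
  ⟨1 + vecMulVec x y, 1, isUnit_det_transv x y h, by simp, by simp⟩

lemma ZEq.right {A : Matrix ι ι ℤ} (x y : ι → ℤ) (h : y ⬝ᵥ x = 0) :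
    ZEq A (A * (1 + vecMulVec x y)) :=
  ⟨1, 1 + vecMulVec x y, by simp, isUnit_det_transv x y h, by simp⟩

lemma ZEq.R1 (D : Matrix ι ι ℤ) (u v x y : ι → ℤ) (h : y ⬝ᵥ x = 0) (hy : y ᵥ* D = 0) :
    ZEq (D + vecMulVec u v) (D + vecMulVec (u + (y ⬝ᵥ u) • x) v) := by
  have := ZEq.left (A := D + vecMulVec u v) x y h
  convert this using 1
  have e : vecMulVec x y * D = 0 := by rw [vecMulVec_mul, hy, vecMulVec_zero]
  simp only [add_mul, mul_add, vecMulVec_mul_vecMulVec, e, add_vecMulVec,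
    smul_vecMulVec, vecMulVec_smul, Matrix.one_mul]
  module

lemma ZEq.R2 (D : Matrix ι ι ℤ) (u v x y : ι → ℤ) (h : y ⬝ᵥ x = 0) (hx : D *ᵥ x = 0) :
    ZEq (D + vecMulVec u v) (D + vecMulVec u (v + (v ⬝ᵥ x) • y)) := by
  have := ZEq.right (A := D + vecMulVec u v) x y h
  convert this using 1
  have e : D * vecMulVec x y = 0 := by rw [mul_vecMulVec, hx, zero_vecMulVec]
  simp only [add_mul, mul_add, vecMulVec_mul_vecMulVec, e, vecMulVec_add,
    smul_vecMulVec, vecMulVec_smul, Matrix.mul_one]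
  module

lemma ZEq.R4 (D : Matrix ι ι ℤ) (u v x : ι → ℤ) (h : v ⬝ᵥ x = 0) (hx : D *ᵥ x = x) :
    ZEq (D + vecMulVec u v) (D + vecMulVec (u - x) v) := by
  have := ZEq.right (A := D + vecMulVec u v) x (-v) (by simpa using h)
  convert this using 1
  have e : D * vecMulVec x v = vecMulVec x v := by rw [mul_vecMulVec, hx]
  simp only [add_mul, mul_add, vecMulVec_mul_vecMulVec, e, vecMulVec_neg, sub_vecMulVec,
    smul_vecMulVec, vecMulVec_smul, Matrix.mul_one, h, mul_neg]
  module

lemma ZEq.R3 (D : Matrix ι ι ℤ) (u v x y : ι → ℤ) (h : y ⬝ᵥ x = 0) (hx : D *ᵥ x = x)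
    (hy : y ᵥ* D = y) :
    ZEq (D + vecMulVec u v)
      (D + vecMulVec (u + (y ⬝ᵥ u) • x) (v - (v ⬝ᵥ x) • y)) := by
  have h1 := ZEq.left (A := D + vecMulVec u v) x y h
  have h2 := ZEq.right (A := (1 + vecMulVec x y) * (D + vecMulVec u v)) x (-y) (by simpa using h)
  convert h1.trans h2 using 1
  have e : D * vecMulVec x y = vecMulVec x y := by rw [mul_vecMulVec, hx]
  have e' : vecMulVec x y * D = vecMulVec x y := by rw [vecMulVec_mul, hy]
  simp only [add_mul, mul_add, vecMulVec_mul_vecMulVec, e, e', vecMulVec_neg, add_vecMulVec,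
    vecMulVec_sub, Matrix.smul_mul, smul_vecMulVec, vecMulVec_smul, Matrix.mul_one, Matrix.one_mul,
    h, mul_neg]
  module

lemma core (d s u v : ι → ℤ) (f g : ι) (p q : ℤ) (hpq : IsCoprime p q)
    (hd : ∀ i, d i = 0 ∨ d i = 1) (hf : d f = 0) (hg : d g = 1) (hsf : s f = 1) (hsg : s g = 1)
    (hu : ∀ i, d i = 0 → u i = q) (hv0 : ∀ i, d i = 0 → v i = -2 * p * s i)
    (hv1 : ∀ i, d i = 1 → v i = -2 * s i) :
    ZEq (diagonal d + vecMulVec u v) (diagonal fun i => if i = f then 2 * p * q else d i) := by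
  have hfg : f ≠ g := by rintro rfl; omega
  set F : ι → ℤ := Pi.single f 1 with hF
  set G : ι → ℤ := Pi.single g 1 with hG
  have hDF : diagonal d *ᵥ F = 0 := by
    ext i; rw [mulVec_diagonal]; by_cases h : i = f <;> simp [hF, h, hf]
  have hDG : diagonal d *ᵥ G = G := by
    ext i; rw [mulVec_diagonal]; by_cases h : i = g <;> simp [hG, h, hg]
  have hFD : F ᵥ* diagonal d = 0 := by
    ext i; rw [vecMul_diagonal]; by_cases h : i = f <;> simp [hF, h, hf]
  have hGD : G ᵥ* diagonal d = G := by
    ext i; rw [vecMul_diagonal]; by_cases h : i = g <;> simp [hG, h, hg]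
  have hFF : F ⬝ᵥ F = 1 := by simp [hF]
  have hGG : G ⬝ᵥ G = 1 := by simp [hG]
  have hFG : F ⬝ᵥ G = 0 := by simp [hF, hG, hfg.symm]
  have hGF : G ⬝ᵥ F = 0 := by simp [hF, hG, hfg]
  -- step 1
  set a : ι → ℤ := fun i => if d i = 1 ∧ i ≠ g then s i else 0 with ha
  have s1 := ZEq.R3 (diagonal d) u v G a (by simp [hG, ha]) hDG (by
    ext i; rw [vecMul_diagonal]
    rcases hd i with h | h <;> simp [ha, h])
  obtain ⟨u1, hu1⟩ : ∃ w, w = u + (a ⬝ᵥ u) • G := ⟨_, rfl⟩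
  rw [← hu1] at s1
  have hu1' : ∀ i, d i = 0 → u1 i = q := by
    intro i hi
    have : i ≠ g := by rintro rfl; omega
    simp [hu1, hG, this, hu i hi]
  -- step 2
  set b : ι → ℤ := fun i => if d i = 0 ∧ i ≠ f then s i else 0 with hb
  have s2 := ZEq.R2 (diagonal d) u1 (v - (v ⬝ᵥ G) • a) F (-b) (by simp [hF, hb]) hDF
  have e2 : v - (v ⬝ᵥ G) • a + ((v - (v ⬝ᵥ G) • a) ⬝ᵥ F) • (-b) = (-2 * p) • F + (-2 : ℤ) • G := by
    ext i
    have h1 : v ⬝ᵥ G = -2 := by simp [hG, hv1 g hg, hsg]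
    have h2 : v ⬝ᵥ F = -2 * p := by simp [hF, hv0 f hf, hsf]
    have h3 : a ⬝ᵥ F = 0 := by simp [hF, ha, hf]
    simp only [sub_dotProduct, smul_dotProduct, h1, h2, h3]
    by_cases hif : i = f
    · subst hif; simp [ha, hb, hF, hG, hf, hfg, hv0 i hf, hsf]
    by_cases hig : i = g
    · subst hig; simp [ha, hb, hF, hG, hg, hif, hv1 i hg, hsg]
    rcases hd i with h | h
    · simp [ha, hb, hF, hG, h, hif, hig, hv0 i h]
    · simp [ha, hb, hF, hG, h, hif, hig, hv1 i h]
  rw [e2] at s2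
  -- step 3
  obtain ⟨x, y, hxy⟩ := hpq
  set C := u1 g with hC
  set e := C * x with he
  -- C - C*y*q = e*p
  have hCe : C + (-C * y) * q - p * e = 0 := by rw [he]; linear_combination -C * hxy
  set c : ι → ℤ := fun i => (if i = g then -C * y else 0) -
    (if d i = 0 ∧ i ≠ f then 1 else 0) with hc
  have s3 := ZEq.R1 (diagonal d) u1 ((-2 * p) • F + (-2 : ℤ) • G) c F
    (by simp [hF, hc, hfg]) hFD
  have hFu : F ⬝ᵥ u1 = q := by simp [hF, hu1' f hf]
  rw [hFu] at s3
  -- step 4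
  set z : ι → ℤ := fun i => if d i = 1 ∧ i ≠ g then u1 i else 0 with hz
  have s4 := ZEq.R4 (diagonal d) (u1 + q • c) ((-2 * p) • F + (-2 : ℤ) • G) z
    (by
      have h1 : F ⬝ᵥ z = 0 := by simp [hF, hz, hf]
      have h2 : G ⬝ᵥ z = 0 := by simp [hG, hz]
      rw [add_dotProduct, smul_dotProduct, smul_dotProduct, h1, h2]; simp) (by
      ext i; rw [mulVec_diagonal]
      rcases hd i with h | h <;> simp [hz, h])
  have e4 : u1 + q • c - z = q • F + (e * p) • G := by
    ext i
    by_cases hif : i = f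
    · subst hif; simp [hc, hz, hF, hG, hf, hfg, hu1' i hf]
    by_cases hig : i = g
    · subst hig; simp [hc, hz, hF, hG, hg, hif]; linear_combination hCe
    rcases hd i with h | h
    · simp [hc, hz, hF, hG, h, hif, hig, hu1' i h]
    · simp [hc, hz, hF, hG, h, hif, hig]
  rw [e4] at s4
  refine (s1.trans s2).trans (s3.trans (s4.trans ?_))
  -- final 2 x 2 reduction
  have t1 := ZEq.right (A := diagonal d + vecMulVec (q • F + (e * p) • G) ((-2 * p) • F + (-2 : ℤ) • G))
    (-p • G) F (by rw [dotProduct_smul, hFG, smul_zero])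
  refine t1.trans ?_
  refine (ZEq.right ((-2 * e) • F) G (by rw [dotProduct_smul, hGF, smul_zero])).trans ?_
  refine (ZEq.left ((2 * q) • F) G (by rw [dotProduct_smul, hGF, smul_zero])).trans ?_
  refine (ZEq.right (p • G) F (by rw [dotProduct_smul, hFG, smul_zero])).trans ?_
  refine ⟨diagonal fun i => if i = f then -1 else 1, 1, ?_, by simp, ?_⟩
  · rw [det_diagonal, IsUnit.prod_univ_iff]
    intro i; split_ifs <;> simp
  have e5 : (1 + vecMulVec ((2 * q) • F) G) * ((diagonal d + vecMulVec (q • F + (e * p) • G) ((-2 * p) • F + (-2 : ℤ) • G)) * (1 + vecMulVec (-p • G) F) * (1 + vecMulVec ((-2 * e) • F) G)) * (1 + vecMulVec (p • G) F) = diagonal d - (2 * p * q) • vecMulVec F F := by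
    have m1 : ∀ w : ι → ℤ, diagonal d * vecMulVec F w = 0 := fun w => by
      rw [mul_vecMulVec, hDF, zero_vecMulVec]
    have m2 : ∀ w : ι → ℤ, diagonal d * vecMulVec G w = vecMulVec G w := fun w => by
      rw [mul_vecMulVec, hDG]
    have m3 : ∀ w : ι → ℤ, vecMulVec w G * diagonal d = vecMulVec w G := fun w => by
      rw [vecMulVec_mul, hGD]
    simp only [add_mul, mul_add, vecMulVec_mul_vecMulVec, m1, m2, m3, vecMulVec_add, add_vecMulVec, smul_vecMulVec, vecMulVec_smul, smul_dotProduct,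
      dotProduct_smul, add_dotProduct, dotProduct_add, hFF, hGG, hFG, hGF, Matrix.mul_one,
      Matrix.one_mul, mulVec_smul, smul_mulVec, smul_vecMul, vecMul_smul, vecMulVec_zero,
      zero_vecMulVec, Matrix.smul_mul, Matrix.mul_smul, smul_eq_mul, smul_zero, mul_zero, zero_mul, add_zero]
    module
  rw [e5, Matrix.mul_one]
  ext i j
  rw [diagonal_mul, Matrix.sub_apply, Matrix.smul_apply, vecMulVec_apply, smul_eq_mul]
  by_cases hij : i = j
  · subst hij
    by_cases hif : i = f
    · subst hif; simp [hF, hf]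
    · simp [hF, hif]
  · by_cases hif : i = f
    · subst hif; simp [hF, hij]
    · simp [hF, hif, hij]


lemma isUnit_det_submatrix {κ : Type*} [Fintype κ] [DecidableEq κ] (U : Matrix κ κ ℤ)
    (hU : IsUnit U.det) (a b : ι ≃ κ) : IsUnit (U.submatrix a b).det := by
  have h : U * U⁻¹ = 1 := mul_nonsing_inv U hU
  have : U.submatrix a b * (U⁻¹).submatrix b a = 1 := by
    rw [submatrix_mul_equiv, h, submatrix_one_equiv]
  exact IsUnit.of_mul_eq_one (b := ((U⁻¹).submatrix b a).det) (by rw [← det_mul, this, det_one])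

lemma ZEq.transfer {κ : Type*} [Fintype κ] [DecidableEq κ] (A : Matrix ι ι ℤ) (B : Matrix κ κ ℤ)
    (φ ψ : κ ≃ ι) (h : ZEq (A.submatrix φ φ) B) : ZEq A (B.submatrix ψ.symm ψ.symm) := by
  obtain ⟨U, V, hU, hV, rfl⟩ := h
  refine ⟨U.submatrix ψ.symm φ.symm, V.submatrix φ.symm ψ.symm, isUnit_det_submatrix U hU _ _,
    isUnit_det_submatrix V hV _ _, ?_⟩
  have hA : A = (A.submatrix φ φ).submatrix φ.symm φ.symm := by simp
  conv_lhs => rw [hA]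
  rw [submatrix_mul_equiv, submatrix_mul_equiv]

end

open scoped Kronecker

/-- prefix sums -/
def L0 (n : ℕ) : Matrix (Fin (n + 1)) (Fin (n + 1)) ℤ := of fun t t' => if t' ≤ t then 1 else 0

/-- identity with last column replaced by ones -/
def V0 (n : ℕ) : Matrix (Fin (n + 1)) (Fin (n + 1)) ℤ :=
  of fun t t' => if t' = Fin.last n then 1 else if t = t' then 1 else 0

/-- cyclic shift -/
def P0 (n : ℕ) : Matrix (Fin (n + 1)) (Fin (n + 1)) ℤ := of fun t t' => if t = t' + 1 then 1 else 0

lemma det_L0 (n : ℕ) : (L0 n).det = 1 := by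
  rw [det_of_isLowerTriangular]
  · simp [L0]
  · intro i j hij
    simp only [OrderDual.toDual_lt_toDual] at hij
    simp [L0, not_le.mpr hij]

lemma det_V0 (n : ℕ) : (V0 n).det = 1 := by
  rw [det_of_isUpperTriangular]
  · simp [V0]
  · intro i j hij
    have h1 : j < i := hij
    have h2 : j ≠ Fin.last n := (lt_of_lt_of_le h1 (Fin.le_last i)).ne
    simp [V0, h2, h1.ne']

lemma sum_shift (n : ℕ) (f : Fin (n + 1) → ℤ) : ∑ t, f (t + 1) = ∑ t, f t :=
  Equiv.sum_comp (Equiv.addRight (1 : Fin (n + 1))) f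

lemma LPV (n : ℕ) : L0 n * (1 - P0 n) * V0 n =
    diagonal fun t => if t = Fin.last n then (0 : ℤ) else 1 := by
  have h1 : ∀ t t', (L0 n * (1 - P0 n)) t t' =
      (if t' ≤ t then 1 else 0) - (if t' + 1 ≤ t then (1 : ℤ) else 0) := by
    intro t t'
    rw [mul_sub, Matrix.mul_one, Matrix.sub_apply, mul_apply]
    simp [L0, P0]
  ext t t'
  rw [mul_apply]
  simp only [h1]
  by_cases h : t' = Fin.last n
  · simp only [V0, h, of_apply, if_true, mul_one, Finset.sum_sub_distrib]
    rw [sum_shift n (fun s => if s ≤ t then (1 : ℤ) else 0), sub_self]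
    by_cases h2 : t = Fin.last n <;> simp [h2]
  · simp only [V0, of_apply, if_neg h, mul_ite, mul_one, mul_zero, Finset.sum_ite_eq',
      Finset.mem_univ, if_true, diagonal_apply]
    have hv : ((t' + 1 : Fin (n + 1)) : ℕ) = t' + 1 := Fin.val_add_one_of_lt (Fin.lt_last_iff_ne_last.mpr h)
    have e1 : t' ≤ t ↔ (t' : ℕ) ≤ t := Iff.rfl
    have e2 : t' + 1 ≤ t ↔ (t' : ℕ) + 1 ≤ t := by rw [Fin.le_def, hv]
    have e3 : t = t' ↔ (t : ℕ) = t' := Fin.ext_iff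
    have e4 : (if t = Fin.last n then (0 : ℤ) else 1) = if (t : ℕ) = n then 0 else 1 := by
      simp [Fin.ext_iff]
    have e5 : (t' : ℕ) ≠ n := fun hh => h (Fin.ext hh)
    rw [e4]
    simp only [e1, e2, e3]
    split_ifs <;> omega

lemma main_prod (n s : ℕ) (hn : 0 < n) (q : ℤ) (hq : IsCoprime ((n + 1 : ℕ) : ℤ) q)
    (c : Fin (n + 1) × Fin (s + 1) → ℤ) (hc : ∀ k, ∑ t, c (t, k) = q)
    (A : Matrix (Fin (n + 1) × Fin (s + 1)) (Fin (n + 1) × Fin (s + 1)) ℤ)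
    (hA : A = (1 - P0 n) ⊗ₖ 1 + vecMulVec c (fun i => -2 * (-1) ^ (i.2 : ℕ))) :
    ZEq A (diagonal fun i => if i = (Fin.last n, 0) then 2 * ((n + 1 : ℕ) : ℤ) * q else
      if i.1 = Fin.last n then 0 else 1) := by
  set b : Fin (n + 1) × Fin (s + 1) → ℤ := fun i => -2 * (-1) ^ (i.2 : ℕ) with hb
  set U : Matrix (Fin (n + 1) × Fin (s + 1)) (Fin (n + 1) × Fin (s + 1)) ℤ := L0 n ⊗ₖ 1 with hU
  set V : Matrix (Fin (n + 1) × Fin (s + 1)) (Fin (n + 1) × Fin (s + 1)) ℤ := V0 n ⊗ₖ 1 with hV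
  have step : ZEq A (diagonal (fun i => if i.1 = Fin.last n then 0 else 1) +
      vecMulVec (U *ᵥ c) (b ᵥ* V)) := by
    refine ⟨U, V, by simp [hU, det_kronecker, det_L0], by simp [hV, det_kronecker, det_V0], ?_⟩
    rw [hA, mul_add, add_mul, mul_vecMulVec, vecMulVec_mul, hU, hV, ← mul_kronecker_mul,
      ← mul_kronecker_mul, LPV]
    congr 1
    rw [Matrix.one_mul, Matrix.one_mul, ← diagonal_one, diagonal_kronecker_diagonal]
    simp
  refine step.trans ?_
  refine core _ (fun i => (-1) ^ (i.2 : ℕ)) _ _ (Fin.last n, 0) (0, 0) _ q hq ?_ ?_ ?_ ?_ ?_ ?_ ?_ ?_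
  · intro i; split_ifs <;> simp
  · simp
  · simp [Fin.ext_iff, hn.ne]
  · simp
  · simp
  · rintro ⟨t, k⟩ h
    have h : t = Fin.last n := by by_contra h'; simp [h'] at h
    subst h
    rw [← hc k]
    simp [mulVec, dotProduct, hU, kroneckerMap_apply, L0, Fintype.sum_prod_type, one_apply,
      Fin.le_last]
  · rintro ⟨t, k⟩ h
    have h : t = Fin.last n := by by_contra h'; simp [h'] at h
    subst h
    simp [vecMul, dotProduct, hV, kroneckerMap_apply, V0, Fintype.sum_prod_type, one_apply, hb]
    ring
  · rintro ⟨t, k⟩ h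
    have h : t ≠ Fin.last n := by rintro rfl; simp at h
    simp [vecMul, dotProduct, hV, kroneckerMap_apply, V0, Fintype.sum_prod_type, one_apply, hb, h]

lemma exists_phi (n s a : ℕ) (hcop : Nat.Coprime (n + 1) a) :
    ∃ φ : Fin (n + 1) × Fin (s + 1) ≃ Fin ((n + 1) * (s + 1)),
      ∀ t k, (φ (t, k) : ℕ) = (k + t * (a * (s + 1))) % ((n + 1) * (s + 1)) := by
  let f : Fin (n + 1) × Fin (s + 1) → Fin ((n + 1) * (s + 1)) := fun x =>
    ⟨(x.2 + x.1 * (a * (s + 1))) % ((n + 1) * (s + 1)), Nat.mod_lt _ (by positivity)⟩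
  have hf : Function.Injective f := by
    rintro ⟨t, k⟩ ⟨t', k'⟩ h
    have h : ((k : ℕ) + t * (a * (s + 1))) ≡ (k' + t' * (a * (s + 1))) [MOD (n + 1) * (s + 1)] :=
      congrArg Fin.val h
    have hk : k = k' := by
      have h1 := h.of_mul_left (n + 1)
      have h2 : ((k : ℕ) + t * (a * (s + 1))) % (s + 1) = (k' + t' * (a * (s + 1))) % (s + 1) := h1
      rw [← mul_assoc, ← mul_assoc, Nat.add_mul_mod_self_right, Nat.add_mul_mod_self_right,
        Nat.mod_eq_of_lt k.2, Nat.mod_eq_of_lt k'.2] at h2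
      exact Fin.ext h2
    subst hk
    have h3 := Nat.ModEq.add_left_cancel' _ h
    rw [← mul_assoc, ← mul_assoc] at h3
    have h4 := Nat.ModEq.mul_right_cancel' (Nat.succ_ne_zero s) h3
    have h5 := Nat.ModEq.cancel_right_of_coprime hcop h4
    have h6 : (t : ℕ) = t' := by
      have := h5
      unfold Nat.ModEq at this
      rwa [Nat.mod_eq_of_lt t.2, Nat.mod_eq_of_lt t'.2] at this
    rw [Fin.ext h6]
  have hb : Function.Bijective f := by
    rw [Fintype.bijective_iff_injective_and_card]
    exact ⟨hf, by simp⟩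
  exact ⟨Equiv.ofBijective f hb, fun t k => rfl⟩

lemma phi_succ (n s a : ℕ) (φ : Fin (n + 1) × Fin (s + 1) ≃ Fin ((n + 1) * (s + 1)))
    (hφ : ∀ t k, (φ (t, k) : ℕ) = (k + t * (a * (s + 1))) % ((n + 1) * (s + 1))) (t k) :
    (φ (t + 1, k) : ℕ) = (φ (t, k) + a * (s + 1)) % ((n + 1) * (s + 1)) := by
  rw [hφ, hφ, Nat.mod_add_mod]
  by_cases h : t = Fin.last n
  · subst h
    have e : (k : ℕ) + (Fin.last n : Fin (n + 1)) * (a * (s + 1)) + a * (s + 1) =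
        k + (n + 1) * (s + 1) * a := by simp only [Fin.val_last]; ring
    rw [e, Nat.add_mul_mod_self_left]
    simp
  · rw [Fin.val_add_one_of_lt (Fin.lt_last_iff_ne_last.mpr h)]
    congr 1; ring

lemma phi_count (n s a : ℕ) (ha : a < n + 1)
    (φ : Fin (n + 1) × Fin (s + 1) ≃ Fin ((n + 1) * (s + 1)))
    (hφ : ∀ t k, (φ (t, k) : ℕ) = (k + t * (a * (s + 1))) % ((n + 1) * (s + 1))) (k) :
    ∑ t, (if (φ (t, k) : ℕ) < a * (s + 1) then (1 : ℤ) else 0) = a := by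
  have hα : a * (s + 1) < (n + 1) * (s + 1) := Nat.mul_lt_mul_of_pos_right ha (Nat.succ_pos s)
  have key : ∀ t, (φ (t, k) : ℤ) + (a * (s + 1) : ℕ) = (φ (t + 1, k) : ℤ) +
      ((n + 1) * (s + 1) : ℕ) * (if (φ (t + 1, k) : ℕ) < a * (s + 1) then (1 : ℤ) else 0) := by
    intro t
    have h1 := phi_succ n s a φ hφ t k
    have h2 := (φ (t, k)).2
    generalize (φ (t, k) : ℕ) = x at *
    generalize (φ (t + 1, k) : ℕ) = y at *
    generalize a * (s + 1) = b at *
    generalize (n + 1) * (s + 1) = c at *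
    by_cases h : x + b < c
    · rw [Nat.mod_eq_of_lt h] at h1
      rw [if_neg (by omega)]; push_cast [h1]; ring
    · rw [Nat.mod_eq_sub_mod (by omega), Nat.mod_eq_of_lt (by omega)] at h1
      rw [if_pos (by omega)]; omega
  have hs := Finset.sum_congr (rfl : (Finset.univ : Finset (Fin (n + 1))) = _) fun t _ => key t
  rw [Finset.sum_add_distrib, Finset.sum_add_distrib, ← Finset.mul_sum,
    sum_shift n (fun t => (φ (t, k) : ℤ)),
    sum_shift n
      (fun t => if (φ (t, k) : ℕ) < a * (s + 1) then (1 : ℤ) else 0)] at hs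
  have hs2 := add_left_cancel hs
  simp only [Finset.sum_const, Finset.card_univ, Fintype.card_fin, nsmul_eq_mul] at hs2
  have hne : (((n + 1) * (s + 1) : ℕ) : ℤ) ≠ 0 := by positivity
  apply mul_left_cancel₀ hne
  rw [← hs2]; push_cast; ring

end G4
theorem G4_ZEquiv_diag
    (p q r p' q' α' m α : ℕ)
    (hpe : Even p) (hqe : Even q)
    (hq : q = m * p + α) (hα0 : 0 < α) (hαp : α < p)
    (hr : r = Nat.gcd p α) (hp' : p = p' * r) (hα' : α = α' * r) (hq' : q = q' * r)
    (G₄ : Matrix (Fin p) (Fin p) ℤ)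
    (hG₄ : G₄ = Matrix.of fun (i j : Fin p) =>
      (if i = j then (1 : ℤ) else 0) +
        (if (i : ℕ) < α then (m : ℤ) + 1 else (m : ℤ)) * ((-1 : ℤ) ^ ((j : ℕ) + 1) * 2) -
        (if (i : ℕ) = ((j : ℕ) + α) % p then 1 else 0)) :
    ∃ U V : Matrix (Fin p) (Fin p) ℤ,
      IsUnit U.det ∧ IsUnit V.det ∧
      U * G₄ * V =
        Matrix.diagonal (fun (i : Fin p) =>
          if (i : ℕ) = 0 then 2 * (p' : ℤ) * (q' : ℤ)
          else if (i : ℕ) < r then 0 else 1) := by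
  have hα2 : Even α := by
    have h : Even (m * p + α) := hq ▸ hqe
    exact (Nat.even_add.mp h).mp (hpe.mul_left m)
  have hr2 : Even r := by
    rw [hr, even_iff_two_dvd]
    exact Nat.dvd_gcd hpe.two_dvd hα2.two_dvd
  have hr0 : 0 < r := by rw [hr]; exact Nat.gcd_pos_of_pos_right _ hα0
  obtain ⟨s, rfl⟩ : ∃ s, r = s + 1 := ⟨r - 1, by omega⟩
  have ha : α' < p' := by
    rw [hα', hp'] at hαp; exact Nat.lt_of_mul_lt_mul_right hαp
  obtain ⟨n, rfl⟩ : ∃ n, p' = n + 1 := ⟨p' - 1, by omega⟩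
  have ha0 : 0 < α' := by
    rcases Nat.eq_zero_or_pos α' with h | h
    · simp [h] at hα'; omega
    · exact h
  have hcop : Nat.Coprime (n + 1) α' := by
    rw [hp', hα', Nat.gcd_mul_right] at hr
    have : 1 * (s + 1) = Nat.gcd (n + 1) α' * (s + 1) := by rw [one_mul]; exact hr
    exact (Nat.eq_of_mul_eq_mul_right (Nat.succ_pos s) this).symm
  clear hr
  subst hp'
  have hqq : q' = m * (n + 1) + α' := by
    apply Nat.eq_of_mul_eq_mul_right (Nat.succ_pos s)
    rw [Nat.succ_eq_add_one, ← hq', hq, hα']; ring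
  subst hα'
  obtain ⟨φ, hφ⟩ := G4.exists_phi n s α' hcop
  have hsucc := G4.phi_succ n s α' φ hφ
  have hcount := G4.phi_count n s α' ha φ hφ
  set c : Fin (n + 1) × Fin (s + 1) → ℤ := fun i =>
    if (φ i : ℕ) < α' * (s + 1) then (m : ℤ) + 1 else (m : ℤ) with hc
  have hpar : ∀ t k, (-1 : ℤ) ^ ((φ (t, k) : ℕ) + 1) * 2 = -2 * (-1) ^ (k : ℕ) := by
    intro t k
    have h1 : Even ((φ (t, k) : ℕ)) ↔ Even (k : ℕ) := by
      have h2 := Nat.div_add_mod ((k : ℕ) + t * (α' * (s + 1))) ((n + 1) * (s + 1))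
      rw [← hφ] at h2
      have h3 : Even ((k : ℕ) + t * (α' * (s + 1))) ↔ Even (k : ℕ) := by
        rw [Nat.even_add]
        simp [hα2.mul_left]
      rw [← h3, ← h2, Nat.even_add]
      simp [hpe.mul_right]
    by_cases h : Even (k : ℕ)
    · rw [pow_succ, (h1.mpr h).neg_one_pow, h.neg_one_pow]; norm_num
    · rw [pow_succ, (Nat.not_even_iff_odd.mp (mt h1.mp h)).neg_one_pow,
        (Nat.not_even_iff_odd.mp h).neg_one_pow]; norm_num
  have main := G4.main_prod n s (by omega) q' (by
      rw [Nat.isCoprime_iff_coprime, hqq]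
      simpa [Nat.coprime_mul_right_add_right] using hcop) c (by
      intro k
      have : ∀ t, c (t, k) = m + (if (φ (t, k) : ℕ) < α' * (s + 1) then (1 : ℤ) else 0) := by
        intro t; simp only [hc]; split_ifs <;> ring
      simp only [this, Finset.sum_add_distrib, hcount]
      rw [hqq]; simp; ring) (G₄.submatrix φ φ) (by
      ext ⟨t, k⟩ ⟨t', k'⟩
      have h1 : (φ (t, k) : ℕ) = ((φ (t', k') : ℕ) + α' * (s + 1)) % ((n + 1) * (s + 1)) ↔
          (t = t' + 1 ∧ k = k') := by
        rw [← hsucc, ← Fin.ext_iff, φ.injective.eq_iff, Prod.mk.injEq]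
      simp only [hG₄, Matrix.submatrix_apply, Matrix.of_apply, Matrix.add_apply,
        Matrix.vecMulVec_apply, Matrix.kroneckerMap_apply, Matrix.sub_apply, hpar, h1,
        φ.injective.eq_iff, Matrix.one_apply, G4.P0, Prod.mk.injEq, hc]
      by_cases hk : k = k'
      · simp only [hk, and_true, if_true, mul_one]; ring
      · simp only [hk, and_false, if_false, mul_zero]; ring)
  have := G4.ZEq.transfer G₄ _ φ
    ((Equiv.prodCongr Fin.revPerm (Equiv.refl _)).trans finProdFinEquiv) main
  obtain ⟨U, V, hU, hV, h⟩ := this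
  refine ⟨U, V, hU, hV, h.trans ?_⟩
  rw [Matrix.submatrix_diagonal_equiv]
  congr 1
  ext i
  obtain ⟨⟨t, k⟩, rfl⟩ := ((Equiv.prodCongr Fin.revPerm (Equiv.refl _)).trans
    finProdFinEquiv : Fin (n + 1) × Fin (s + 1) ≃ _).surjective i
  simp only [Function.comp_apply, Equiv.symm_apply_apply, Prod.mk.injEq]
  have hv : ((((Equiv.prodCongr Fin.revPerm (Equiv.refl _)).trans
    finProdFinEquiv : Fin (n + 1) × Fin (s + 1) ≃ _) (t, k) : Fin ((n + 1) * (s + 1))) : ℕ) =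
      k + (s + 1) * (n - t) := by
    simp [finProdFinEquiv, Fin.val_rev]
  rw [hv]
  have hk := k.2
  have ht := t.2
  by_cases h1 : t = Fin.last n
  · subst h1
    have : (k : ℕ) = 0 ↔ k = 0 := by rw [Fin.ext_iff]; rfl
    simp [this, hk]
  · have h2 : (t : ℕ) < n := Fin.lt_last_iff_ne_last.mpr h1
    have h3 : (s + 1) * 1 ≤ (s + 1) * (n - t) := Nat.mul_le_mul_left _ (by omega)
    rw [if_neg (by simp [h1]), if_neg h1, if_neg (by omega), if_neg (by omega)]
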